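/- arXiv:2411.04205 — 6 statements merged into one kernel-verified Lean document; each statement's English description precedes it below -/
import Mathlib

section
/- Let P, P', Q, Q' be probability measures on a measurable space Ω, let ε ∈ ℝ and η, δ ≥ 0. If d_TV(P, P') ≤ η, d_TV(Q, Q') ≤ η, and D_{e^ε}(P' ‖ Q') ≤ δ, then D_{e^ε}(P ‖ Q) ≤ δ + η·(1 + e^ε). -/
open MeasureTheory ProbabilityTheory

/-- Hockey-stick divergence `D_{e^ε}(P ‖ Q) = sup_Γ (P(Γ) − e^ε·Q(Γ))`,
where the supremum is over measurable sets `Γ`. -/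
noncomputable def hsDiv {Ω : Type*} [MeasurableSpace Ω] (ε : ℝ) (P Q : Measure Ω) : ℝ :=
  ⨆ Γ : {s : Set Ω // MeasurableSet s}, ((P Γ.1).toReal - Real.exp ε * (Q Γ.1).toReal)

/-- Total variation distance `d_TV(P, P') = sup_Γ |P(Γ) − P'(Γ)|`. -/
noncomputable def tvDist {Ω : Type*} [MeasurableSpace Ω] (P P' : Measure Ω) : ℝ :=
  ⨆ Γ : {s : Set Ω // MeasurableSet s}, |(P Γ.1).toReal - (P' Γ.1).toReal|

theorem prob_toReal_bounds {Ω : Type*} [MeasurableSpace Ω] (P : Measure Ω)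
    [IsProbabilityMeasure P] (s : Set Ω) : 0 ≤ (P s).toReal ∧ (P s).toReal ≤ 1 :=
  ⟨ENNReal.toReal_nonneg, measureReal_le_one (μ := P) (s := s)⟩

theorem le_tvDist {Ω : Type*} [MeasurableSpace Ω] (P P' : Measure Ω)
    [IsProbabilityMeasure P] [IsProbabilityMeasure P'] (Γ : {s : Set Ω // MeasurableSet s}) :
    |(P Γ.1).toReal - (P' Γ.1).toReal| ≤ tvDist P P' := by
  refine le_ciSup (f := fun Γ : {s : Set Ω // MeasurableSet s} =>
    |(P Γ.1).toReal - (P' Γ.1).toReal|) ⟨1, ?_⟩ Γ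
  rintro _ ⟨G, rfl⟩
  have h1 := prob_toReal_bounds P G.1
  have h2 := prob_toReal_bounds P' G.1
  exact abs_le.2 ⟨by linarith, by linarith⟩

theorem le_hsDiv {Ω : Type*} [MeasurableSpace Ω] (ε : ℝ) (P Q : Measure Ω)
    [IsProbabilityMeasure P] [IsProbabilityMeasure Q] (Γ : {s : Set Ω // MeasurableSet s}) :
    (P Γ.1).toReal - Real.exp ε * (Q Γ.1).toReal ≤ hsDiv ε P Q := by
  refine le_ciSup (f := fun Γ : {s : Set Ω // MeasurableSet s} =>
    (P Γ.1).toReal - Real.exp ε * (Q Γ.1).toReal) ⟨1, ?_⟩ Γ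
  rintro _ ⟨G, rfl⟩
  have h1 := prob_toReal_bounds P G.1
  have h2 := mul_nonneg (Real.exp_pos ε).le (prob_toReal_bounds Q G.1).1
  show (P G.1).toReal - Real.exp ε * (Q G.1).toReal ≤ 1
  linarith

theorem stmt_0 {Ω : Type*} [MeasurableSpace Ω] (P P' Q Q' : Measure Ω)
    [IsProbabilityMeasure P] [IsProbabilityMeasure P']
    [IsProbabilityMeasure Q] [IsProbabilityMeasure Q']
    (ε η δ : ℝ) (hη : 0 ≤ η) (hδ : 0 ≤ δ)
    (hP : tvDist P P' ≤ η) (hQ : tvDist Q Q' ≤ η)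
    (hPQ : hsDiv ε P' Q' ≤ δ) :
    hsDiv ε P Q ≤ δ + η * (1 + Real.exp ε) := by
  haveI : Nonempty {s : Set Ω // MeasurableSet s} := ⟨⟨∅, MeasurableSet.empty⟩⟩
  refine ciSup_le fun Γ => ?_
  have h1 := (abs_le.1 ((le_tvDist P P' Γ).trans hP)).2
  have h2 := (abs_le.1 ((le_tvDist Q Q' Γ).trans hQ)).1
  have h3 := (le_hsDiv ε P' Q' Γ).trans hPQ
  have h4 : Real.exp ε * ((Q' Γ.1).toReal - (Q Γ.1).toReal) ≤ Real.exp ε * η :=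
    mul_le_mul_of_nonneg_left (by linarith) (Real.exp_pos ε).le
  linarith
end

section
/- For every σ' > 0 and ε ≥ 0, with P = N(1, σ'²) and Q = N(0, σ'²) one has D_{e^ε}(P ‖ Q) = Φ(−σ'·ε + 1/(2σ')) − e^ε·Φ(−σ'·ε − 1/(2σ')). -/
open MeasureTheory ProbabilityTheory

/-- CDF of the standard normal distribution. -/
noncomputable def stdNormalCDF (x : ℝ) : ℝ := ((gaussianReal 0 1) (Set.Iic x)).toReal

lemma gauss_Ici (s : ℝ) (hs : 0 < s) (m t : ℝ) :
    ((gaussianReal m (Real.toNNReal (s ^ 2))) (Set.Ici t)).toReal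
      = stdNormalCDF ((m - t) / s) := by
  have h1 : gaussianReal m (Real.toNNReal (s ^ 2))
      = (gaussianReal 0 1).map (fun x => m - s * x) := by
    have : (fun x : ℝ => m - s * x) = (fun y => m - y) ∘ (fun x => s * x) := rfl
    rw [this, ← Measure.map_map (by fun_prop) (by fun_prop), gaussianReal_map_const_mul,
      gaussianReal_map_const_sub]
    congr 1
    · simp
    · ext
      simp [sq_nonneg]
  rw [h1, Measure.map_apply (by fun_prop) measurableSet_Ici, stdNormalCDF]
  congr 2
  ext x
  simp only [Set.mem_preimage, Set.mem_Ici, Set.mem_Iic]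
  rw [le_div_iff₀ hs]
  constructor <;> intro h <;> linarith

lemma pdf_ratio (s : ℝ) (hs : 0 < s) (ε x : ℝ) :
    gaussianPDFReal 1 (Real.toNNReal (s ^ 2)) x
        - Real.exp ε * gaussianPDFReal 0 (Real.toNNReal (s ^ 2)) x
      = gaussianPDFReal 0 (Real.toNNReal (s ^ 2)) x
        * (Real.exp ((x - 1 / 2) / s ^ 2) - Real.exp ε) := by
  have : gaussianPDFReal 1 (Real.toNNReal (s ^ 2)) x
      = gaussianPDFReal 0 (Real.toNNReal (s ^ 2)) x * Real.exp ((x - 1 / 2) / s ^ 2) := by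
    simp only [gaussianPDFReal, Real.coe_toNNReal _ (sq_nonneg s)]
    rw [mul_assoc (_⁻¹) (Real.exp _), ← Real.exp_add]
    congr 2
    field_simp
    ring
  rw [this]
  ring

theorem stmt_1 (σ' : ℝ) (hσ' : 0 < σ') (ε : ℝ) (hε : 0 ≤ ε) :
    hsDiv ε (gaussianReal 1 (Real.toNNReal (σ' ^ 2))) (gaussianReal 0 (Real.toNNReal (σ' ^ 2)))
      = stdNormalCDF (-σ' * ε + 1 / (2 * σ'))
        - Real.exp ε * stdNormalCDF (-σ' * ε - 1 / (2 * σ')) := by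
  have hs2 : 0 < σ' ^ 2 := by positivity
  have hv : Real.toNNReal (σ' ^ 2) ≠ 0 := (Real.toNNReal_pos.mpr hs2).ne'
  have e1 : -σ' * ε + 1 / (2 * σ') = (1 - (σ' ^ 2 * ε + 1 / 2)) / σ' := by
    field_simp
    ring
  have e2 : -σ' * ε - 1 / (2 * σ') = (0 - (σ' ^ 2 * ε + 1 / 2)) / σ' := by
    field_simp
    ring
  rw [e1, e2, ← gauss_Ici σ' hσ', ← gauss_Ici σ' hσ']
  set t := σ' ^ 2 * ε + 1 / 2 with ht
  set v := Real.toNNReal (σ' ^ 2) with hvdef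
  have hi1 := integrable_gaussianPDFReal 1 v
  have hi0 := (integrable_gaussianPDFReal 0 v).const_mul (Real.exp ε)
  have hi := hi1.sub hi0
  have key : ∀ S : Set ℝ, MeasurableSet S →
      (gaussianReal 1 v S).toReal - Real.exp ε * (gaussianReal 0 v S).toReal
      = ∫ x, S.indicator
        (fun x => gaussianPDFReal 1 v x - Real.exp ε * gaussianPDFReal 0 v x) x := by
    intro S hS
    rw [integral_indicator hS, integral_sub hi1.integrableOn hi0.integrableOn,
      integral_const_mul, gaussianReal_apply_eq_integral _ hv,
      gaussianReal_apply_eq_integral _ hv,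
      ENNReal.toReal_ofReal (integral_nonneg fun x => gaussianPDFReal_nonneg _ _ _),
      ENNReal.toReal_ofReal (integral_nonneg fun x => gaussianPDFReal_nonneg _ _ _)]
  have ub : ∀ Γ : {s : Set ℝ // MeasurableSet s},
      (gaussianReal 1 v Γ.1).toReal - Real.exp ε * (gaussianReal 0 v Γ.1).toReal
      ≤ (gaussianReal 1 v (Set.Ici t)).toReal
        - Real.exp ε * (gaussianReal 0 v (Set.Ici t)).toReal := by
    rintro ⟨S, hS⟩
    rw [key S hS, key _ measurableSet_Ici]
    refine integral_mono (hi.indicator hS) (hi.indicator measurableSet_Ici) fun x => ?_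
    have hp := gaussianPDFReal_nonneg 0 v x
    have hr := pdf_ratio σ' hσ' ε x
    rw [← hvdef] at hr
    simp only [Set.indicator_apply, Set.mem_Ici, hr]
    by_cases hx : t ≤ x
    · have : 0 ≤ gaussianPDFReal 0 v x
          * (Real.exp ((x - 1 / 2) / σ' ^ 2) - Real.exp ε) := by
        refine mul_nonneg hp (sub_nonneg.mpr (Real.exp_le_exp.mpr ?_))
        rw [le_div_iff₀ hs2]
        linarith
      by_cases hxS : x ∈ S <;> simp only [hx, hxS, Set.indicator_of_mem, Set.indicator_of_notMem,
        not_false_eq_true, if_true, hr, this, le_refl]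
    · have : gaussianPDFReal 0 v x
          * (Real.exp ((x - 1 / 2) / σ' ^ 2) - Real.exp ε) ≤ 0 := by
        refine mul_nonpos_of_nonneg_of_nonpos hp (sub_nonpos.mpr (Real.exp_le_exp.mpr ?_))
        rw [div_le_iff₀ hs2]
        linarith
      by_cases hxS : x ∈ S <;> simp only [hx, hxS, Set.indicator_of_mem, Set.indicator_of_notMem,
        not_false_eq_true, if_false, hr, this, le_refl]
  have : Nonempty {s : Set ℝ // MeasurableSet s} := ⟨⟨_, MeasurableSet.empty⟩⟩
  unfold hsDiv
  apply le_antisymm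
  · exact ciSup_le ub
  · exact le_ciSup (f := fun Γ : {s : Set ℝ // MeasurableSet s} =>
      (gaussianReal 1 v Γ.1).toReal - Real.exp ε * (gaussianReal 0 v Γ.1).toReal)
      ⟨_, Set.forall_mem_range.mpr ub⟩ ⟨Set.Ici t, measurableSet_Ici⟩
end

section
/- For every integer E ≥ 1, σ > 0, and ε ∈ ℝ, the hockey-stick divergence between the E-fold product measures satisfies D_{e^ε}(N(1,σ²)^{⊗E} ‖ N(0,σ²)^{⊗E}) = D_{e^ε}(N(1, σ²/E) ‖ N(0, σ²/E)); that is, E-fold composition of the Gaussian mechanism with noise scale σ is equivalent to a single Gaussian mechanism with noise scale σ/√E. -/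
open MeasureTheory ProbabilityTheory

lemma aux_suff {Ω : Type*} [MeasurableSpace Ω] (P Q : Measure Ω) [IsProbabilityMeasure P]
    [IsProbabilityMeasure Q] (T : Ω → ℝ) (hT : Measurable T) (g : ℝ → ENNReal)
    (hg : Measurable g) (hd : P = Q.withDensity (fun x => g (T x))) (ε : ℝ) :
    hsDiv ε P Q = hsDiv ε (P.map T) (Q.map T) := by
  have := Measure.isProbabilityMeasure_map (μ := P) hT.aemeasurable
  have := Measure.isProbabilityMeasure_map (μ := Q) hT.aemeasurable
  have bdd : ∀ {X : Type _} [MeasurableSpace X] (P Q : Measure X) [IsProbabilityMeasure P],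
      BddAbove (Set.range fun Γ : {s : Set X // MeasurableSet s} =>
        ((P Γ.1).toReal - Real.exp ε * (Q Γ.1).toReal)) := by
    intro X _ P Q _
    refine ⟨1, ?_⟩
    rintro _ ⟨Γ, rfl⟩
    have h1 : (P Γ.1).toReal ≤ 1 := measureReal_le_one
    have h2 : 0 ≤ Real.exp ε * (Q Γ.1).toReal := by positivity
    simp only
    linarith
  have bdd' : BddAbove (Set.range fun Γ : {s : Set ℝ // MeasurableSet s} =>
        ((P.map T Γ.1).toReal - Real.exp ε * (Q.map T Γ.1).toReal)) := by
    refine ⟨1, ?_⟩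
    rintro _ ⟨Γ, rfl⟩
    have h1 : (P.map T Γ.1).toReal ≤ 1 := measureReal_le_one
    have h2 : 0 ≤ Real.exp ε * (Q.map T Γ.1).toReal := by positivity
    simp only
    linarith
  have : Nonempty {s : Set Ω // MeasurableSet s} := ⟨⟨∅, MeasurableSet.empty⟩⟩
  have : Nonempty {s : Set ℝ // MeasurableSet s} := ⟨⟨∅, MeasurableSet.empty⟩⟩
  apply le_antisymm
  · refine ciSup_le ?_
    rintro ⟨Γ, hΓ⟩
    let A : Set ℝ := {y | ENNReal.ofReal (Real.exp ε) ≤ g y}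
    have hA : MeasurableSet A := measurableSet_le measurable_const hg
    have hB : MeasurableSet (T ⁻¹' A) := hT hA
    refine le_trans ?_ (le_ciSup bdd' ⟨A, hA⟩)
    simp only [Measure.map_apply hT hA]
    have hgT : Measurable fun x => g (T x) := hg.comp hT
    have e1 : ∀ S : Set Ω, MeasurableSet S → S ⊆ T ⁻¹' A →
        Real.exp ε * (Q S).toReal ≤ (P S).toReal := by
      intro S hS hSA
      have h : ENNReal.ofReal (Real.exp ε) * Q S ≤ P S := by
        rw [hd, withDensity_apply _ hS, ← setLIntegral_const]
        exact setLIntegral_mono hgT fun x hx => hSA hx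
      have h' := ENNReal.toReal_mono (measure_ne_top P S) h
      rwa [ENNReal.toReal_mul, ENNReal.toReal_ofReal (Real.exp_pos _).le] at h'
    have e2 : ∀ S : Set Ω, MeasurableSet S → S ⊆ (T ⁻¹' A)ᶜ →
        (P S).toReal ≤ Real.exp ε * (Q S).toReal := by
      intro S hS hSA
      have h : P S ≤ ENNReal.ofReal (Real.exp ε) * Q S := by
        rw [hd, withDensity_apply _ hS, ← setLIntegral_const]
        refine setLIntegral_mono measurable_const fun x hx => ?_
        have hn : ¬ ENNReal.ofReal (Real.exp ε) ≤ g (T x) := hSA hx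
        exact (not_le.1 hn).le
      have h' := ENNReal.toReal_mono
        (ENNReal.mul_ne_top ENNReal.ofReal_ne_top (measure_ne_top Q S)) h
      rwa [ENNReal.toReal_mul, ENNReal.toReal_ofReal (Real.exp_pos _).le] at h'
    have a1 := e1 (T ⁻¹' A \ Γ) (hB.diff hΓ) Set.sdiff_subset
    have a2 := e2 (Γ \ T ⁻¹' A) (hΓ.diff hB) (fun x hx => hx.2)
    have p1 : P.real (Γ ∩ T ⁻¹' A) + P.real (Γ \ T ⁻¹' A) = P.real Γ :=
      measureReal_inter_add_sdiff hB
    have p2 : P.real (T ⁻¹' A ∩ Γ) + P.real (T ⁻¹' A \ Γ) = P.real (T ⁻¹' A) :=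
      measureReal_inter_add_sdiff hΓ
    have q1 : Q.real (Γ ∩ T ⁻¹' A) + Q.real (Γ \ T ⁻¹' A) = Q.real Γ :=
      measureReal_inter_add_sdiff hB
    have q2 : Q.real (T ⁻¹' A ∩ Γ) + Q.real (T ⁻¹' A \ Γ) = Q.real (T ⁻¹' A) :=
      measureReal_inter_add_sdiff hΓ
    rw [Set.inter_comm] at p2 q2
    simp only [← measureReal_def] at a1 a2 ⊢
    rw [← p1, ← p2, ← q1, ← q2]
    linarith
  · refine ciSup_le ?_
    rintro ⟨A, hA⟩
    simp only [Measure.map_apply hT hA]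
    exact le_ciSup (bdd P Q) ⟨T ⁻¹' A, hT hA⟩

lemma aux_dens (v : NNReal) (hv : v ≠ 0) :
    gaussianReal 1 v = (gaussianReal 0 v).withDensity
      (fun x => ENNReal.ofReal (Real.exp ((2 * x - 1) / (2 * v)))) := by
  rw [gaussianReal_of_var_ne_zero _ hv, gaussianReal_of_var_ne_zero _ hv,
    ← withDensity_mul _ (measurable_gaussianPDF _ _) (by fun_prop)]
  congr 1
  funext x
  have hv' : (v : ℝ) ≠ 0 := by exact_mod_cast hv
  simp only [Pi.mul_apply, gaussianPDF, gaussianPDFReal]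
  rw [← ENNReal.ofReal_mul (by positivity), mul_assoc (_)⁻¹, ← Real.exp_add]
  congr 3
  field_simp
  ring

lemma aux_pi (E : ℕ) (v : NNReal) (hv : v ≠ 0) :
    (Measure.pi fun _ : Fin E => gaussianReal 1 v) =
      (Measure.pi fun _ : Fin E => gaussianReal 0 v).withDensity
      (fun x => ∏ i, ENNReal.ofReal (Real.exp ((2 * x i - 1) / (2 * v)))) := by
  apply Measure.pi_eq
  intro s hs
  rw [withDensity_apply _ (MeasurableSet.univ_pi hs),
    ← lintegral_indicator (MeasurableSet.univ_pi hs)]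
  let h : Fin E → ℝ → ENNReal := fun i => (s i).indicator
    (fun x => ENNReal.ofReal (Real.exp ((2 * x - 1) / (2 * v))))
  have hm : ∀ i, Measurable (h i) := fun i =>
    Measurable.indicator (by fun_prop) (hs i)
  have h1 : ∀ x : Fin E → ℝ, (Set.univ.pi s).indicator (fun x : Fin E → ℝ =>
      ∏ i, ENNReal.ofReal (Real.exp ((2 * x i - 1) / (2 * v)))) x = ∏ i, h i (x i) := by
    intro x
    by_cases hx : x ∈ Set.univ.pi s
    · rw [Set.indicator_of_mem hx]
      refine Finset.prod_congr rfl fun i _ => ?_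
      have hi : x i ∈ s i := hx i (Set.mem_univ i)
      simp [h, hi]
    · rw [Set.indicator_of_notMem hx]
      simp only [Set.mem_pi, Set.mem_univ, true_imp_iff, not_forall] at hx
      obtain ⟨i, hi⟩ := hx
      have hz : h i (x i) = 0 := Set.indicator_of_notMem hi _
      exact (Finset.prod_eq_zero (Finset.mem_univ i) hz).symm
  simp_rw [h1]
  rw [lintegral_prod_eq_prod_lintegral_of_indepFun Finset.univ
    (fun i (x : Fin E → ℝ) => h i (x i)) (iIndepFun_pi fun i => (hm i).aemeasurable)
    (fun i => (hm i).comp (measurable_pi_apply i))]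
  refine Finset.prod_congr rfl fun i _ => ?_
  rw [(measurePreserving_eval (fun _ : Fin E => gaussianReal 0 v) i).lintegral_comp (hm i),
    lintegral_indicator (hs i), aux_dens v hv, withDensity_apply _ (hs i)]

lemma aux_map (E : ℕ) (hE : 1 ≤ E) (σ : ℝ) (m : ℝ) :
    (Measure.pi fun _ : Fin E => gaussianReal m (Real.toNNReal (σ ^ 2))).map
      (fun x : Fin E → ℝ => (∑ i, x i) / (E : ℝ)) = gaussianReal m (Real.toNNReal (σ ^ 2 / E)) := by
  have hT : Measurable (fun x : Fin E → ℝ => (∑ i, x i) / (E : ℝ)) := by fun_prop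
  have := Measure.isProbabilityMeasure_map
    (μ := Measure.pi fun _ : Fin E => gaussianReal m (Real.toNNReal (σ ^ 2))) hT.aemeasurable
  have hE0 : (E : ℂ) ≠ 0 := by exact_mod_cast (by omega : E ≠ 0)
  apply Measure.ext_of_charFun
  funext t
  rw [charFun_apply_real, integral_map hT.aemeasurable (by fun_prop)]
  have h1 : ∀ x : Fin E → ℝ, Complex.exp (t * (((∑ i, x i) / (E : ℝ) : ℝ) : ℂ) * Complex.I)
      = ∏ i, Complex.exp (((t / E : ℝ) : ℂ) * (x i : ℂ) * Complex.I) := by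
    intro x
    rw [← Complex.exp_sum, ← Finset.sum_mul, ← Finset.mul_sum]
    push_cast
    congr 1
    ring
  simp_rw [h1]
  rw [integral_fintype_prod_eq_pow
    (fun y : ℝ => Complex.exp (((t / E : ℝ) : ℂ) * (y : ℂ) * Complex.I)),
    ← charFun_apply_real, charFun_gaussianReal, charFun_gaussianReal, ← Complex.exp_nat_mul,
    Fintype.card_fin, Real.coe_toNNReal _ (by positivity), Real.coe_toNNReal _ (by positivity)]
  congr 1
  push_cast
  field_simp

theorem stmt_3 (E : ℕ) (hE : 1 ≤ E) (σ : ℝ) (hσ : 0 < σ) (ε : ℝ) :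
    hsDiv ε (Measure.pi fun _ : Fin E => gaussianReal 1 (Real.toNNReal (σ ^ 2)))
        (Measure.pi fun _ : Fin E => gaussianReal 0 (Real.toNNReal (σ ^ 2)))
      = hsDiv ε (gaussianReal 1 (Real.toNNReal (σ ^ 2 / E)))
          (gaussianReal 0 (Real.toNNReal (σ ^ 2 / E))) := by
  have hv : Real.toNNReal (σ ^ 2) ≠ 0 := by
    have : 0 < σ ^ 2 := by positivity
    simpa using hσ.ne'
  rw [← aux_map E hE σ 1, ← aux_map E hE σ 0]
  have hd := aux_pi E _ hv
  set v := Real.toNNReal (σ ^ 2)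
  have hT : Measurable (fun x : Fin E → ℝ => (∑ i, x i) / (E : ℝ)) := by fun_prop
  have hP : IsProbabilityMeasure (Measure.pi fun _ : Fin E => gaussianReal 1 v) := inferInstance
  have hQ : IsProbabilityMeasure (Measure.pi fun _ : Fin E => gaussianReal 0 v) := inferInstance
  have hE0 : (E : ℝ) ≠ 0 := by exact_mod_cast (by omega : E ≠ 0)
  have hg : (fun x : Fin E → ℝ => ∏ i, ENNReal.ofReal (Real.exp ((2 * x i - 1) / (2 * v))))
      = fun x => ENNReal.ofReal (Real.exp (E * (2 * ((∑ i, x i) / (E : ℝ)) - 1) / (2 * v))) := by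
    funext x
    rw [← ENNReal.ofReal_prod_of_nonneg (fun i _ => (Real.exp_pos _).le), ← Real.exp_sum,
      ← Finset.sum_div, Finset.sum_sub_distrib, ← Finset.mul_sum]
    congr 3
    simp
    field_simp
  rw [hg] at hd
  exact aux_suff _ _ _ hT
    (fun y => ENNReal.ofReal (Real.exp (E * (2 * y - 1) / (2 * v)))) (by fun_prop) hd ε
end

section
/- For every dimension d ≥ 1, mean vectors μ₁, μ₂ ∈ ℝ^d, σ > 0, and ε ∈ ℝ, one has D_{e^ε}(N(μ₁, σ²I_d) ‖ N(μ₂, σ²I_d)) = D_{e^ε}(N(‖μ₁ − μ₂‖₂, σ²) ‖ N(0, σ²)); that is, the hockey-stick divergence between two isotropic Gaussians with common variance depends only on the Euclidean distance between their means. -/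
open MeasureTheory ProbabilityTheory

lemma aux_pi_withDensity {d : ℕ} (μ : Fin d → Measure ℝ) [∀ i, IsProbabilityMeasure (μ i)]
    (f : Fin d → ℝ → ENNReal) (hf : ∀ i, Measurable (f i))
    [∀ i, SigmaFinite ((μ i).withDensity (f i))] :
    Measure.pi (fun i => (μ i).withDensity (f i))
      = (Measure.pi μ).withDensity (fun x => ∏ i, f i (x i)) := by
  refine Measure.pi_eq fun s hs => ?_
  rw [withDensity_apply _ (MeasurableSet.univ_pi hs),
    ← lintegral_indicator (MeasurableSet.univ_pi hs)]
  have h1 : (Set.univ.pi s).indicator (fun x : Fin d → ℝ => ∏ i, f i (x i))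
      = fun x => ∏ i, (s i).indicator (f i) (x i) := by
    funext x
    by_cases hx : x ∈ Set.univ.pi s
    · rw [Set.indicator_of_mem hx]
      refine Finset.prod_congr rfl fun i _ => ?_
      rw [Set.indicator_of_mem (hx i trivial)]
    · rw [Set.indicator_of_notMem hx]
      simp only [Set.mem_pi, Set.mem_univ, true_implies, not_forall] at hx
      obtain ⟨i, hi⟩ := hx
      exact (Finset.prod_eq_zero (Finset.mem_univ i) (Set.indicator_of_notMem hi _)).symm
  have hm : ∀ i, Measurable ((s i).indicator (f i)) := fun i => (hf i).indicator (hs i)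
  rw [h1, lintegral_prod_eq_prod_lintegral_of_indepFun Finset.univ
    (fun i (x : Fin d → ℝ) => (s i).indicator (f i) (x i))
    (iIndepFun_pi fun i => (hm i).aemeasurable)
    (fun i => (hm i).comp (measurable_pi_apply i))]
  refine Finset.prod_congr rfl fun i _ => ?_
  rw [withDensity_apply _ (hs i), ← lintegral_indicator (hs i)]
  exact (measurePreserving_eval μ i).lintegral_comp (hm i)

lemma aux_gauss_density (a b σ : ℝ) (hσ : 0 < σ) :
    gaussianReal a (Real.toNNReal (σ ^ 2)) = (gaussianReal b (Real.toNNReal (σ ^ 2))).withDensity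
      (fun x => ENNReal.ofReal (Real.exp (((a - b) * (x - b) - (a - b) ^ 2 / 2) / σ ^ 2))) := by
  have h2 : (0 : ℝ) < σ ^ 2 := by positivity
  have hv : Real.toNNReal (σ ^ 2) ≠ 0 := by simpa using hσ.ne'
  rw [gaussianReal_of_var_ne_zero _ hv, gaussianReal_of_var_ne_zero _ hv,
    ← withDensity_mul _ (measurable_gaussianPDF _ _) (by fun_prop)]
  congr 1
  funext x
  simp only [Pi.mul_apply, gaussianPDF]
  rw [← ENNReal.ofReal_mul (gaussianPDFReal_nonneg _ _ _)]
  congr 1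
  simp only [gaussianPDFReal, Real.coe_toNNReal _ h2.le]
  rw [mul_assoc (_⁻¹), ← Real.exp_add]
  congr 2
  field_simp
  ring

lemma aux_map_s4 {d : ℕ} (m u : Fin d → ℝ) (hu : ∑ i, u i ^ 2 = 1) (v : NNReal) :
    (Measure.pi fun i => gaussianReal (m i) v).map (fun x => ∑ i, u i * (x i - m i))
      = gaussianReal 0 v := by
  apply Measure.ext_of_charFun
  ext t
  rw [charFun_apply_real, integral_map (Measurable.aemeasurable (by fun_prop)) (by fun_prop), charFun_gaussianReal]
  have h : ∀ x : Fin d → ℝ, Complex.exp (t * (∑ i, u i * (x i - m i) : ℝ) * Complex.I)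
      = ∏ i, (Complex.exp (-(t * u i * m i) * Complex.I)
        * Complex.exp ((t * u i : ℝ) * (x i) * Complex.I)) := by
    intro x
    simp_rw [← Complex.exp_add]
    rw [← Complex.exp_sum]
    congr 1
    push_cast
    rw [Finset.mul_sum, Finset.sum_mul]
    refine Finset.sum_congr rfl fun i _ => ?_
    ring
  simp_rw [h]
  rw [integral_fintype_prod_eq_prod (f := fun i (x : ℝ) =>
    (Complex.exp (-(t * u i * m i) * Complex.I) * Complex.exp ((t * u i : ℝ) * x * Complex.I)))]
  simp_rw [integral_const_mul, ← charFun_apply_real, charFun_gaussianReal, ← Complex.exp_add]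
  rw [← Complex.exp_sum]
  congr 1
  have hu' : ∑ i, (u i : ℂ) ^ 2 = 1 := by exact_mod_cast hu
  have : ∀ i, -(t * u i * m i) * Complex.I + ((t * u i : ℝ) * m i * Complex.I
      - v * (t * u i : ℝ) ^ 2 / 2) = (-(v * t ^ 2 / 2) : ℂ) * (u i : ℂ) ^ 2 := by
    intro i; push_cast; ring
  rw [Finset.sum_congr rfl fun i _ => this i, ← Finset.mul_sum, hu']
  simp

lemma aux_hs {Ω : Type*} [MeasurableSpace Ω] (ε : ℝ) (P Q : Measure Ω) (P' Q' : Measure ℝ)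
    [IsProbabilityMeasure P] [IsProbabilityMeasure Q]
    [IsProbabilityMeasure P'] [IsProbabilityMeasure Q']
    (T : Ω → ℝ) (hT : Measurable T) (g : ℝ → ℝ) (hg : Measurable g) (hg0 : ∀ x, 0 ≤ g x)
    (hQ : Q.map T = Q') (hP : P = Q.withDensity (fun x => ENNReal.ofReal (g (T x))))
    (hP' : P' = Q'.withDensity (fun x => ENNReal.ofReal (g x))) :
    hsDiv ε P Q = hsDiv ε P' Q' := by
  have hb : ∀ {Ω : Type _} [MeasurableSpace Ω] (P Q : Measure Ω) [IsProbabilityMeasure P]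
      [IsProbabilityMeasure Q], BddAbove (Set.range fun Γ : {s : Set Ω // MeasurableSet s} =>
        ((P Γ.1).toReal - Real.exp ε * (Q Γ.1).toReal)) := by
    intro Ω _ P Q _ _
    refine ⟨1, ?_⟩
    rintro _ ⟨Γ, rfl⟩
    have h1 : (P Γ.1).toReal ≤ 1 := measureReal_le_one
    have h2 : 0 ≤ Real.exp ε * (Q Γ.1).toReal := by positivity
    simp only
    linarith
  have hb' : BddAbove (Set.range fun Γ : {s : Set ℝ // MeasurableSet s} =>
        ((P' Γ.1).toReal - Real.exp ε * (Q' Γ.1).toReal)) := by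
    refine ⟨1, ?_⟩
    rintro _ ⟨Γ, rfl⟩
    have h1 : (P' Γ.1).toReal ≤ 1 := measureReal_le_one
    have h2 : 0 ≤ Real.exp ε * (Q' Γ.1).toReal := by positivity
    simp only
    linarith
  have hmapQ : ∀ A, MeasurableSet A → Q' A = Q (T ⁻¹' A) := fun A hA => by
    rw [← hQ, Measure.map_apply hT hA]
  have hmapP : ∀ A, MeasurableSet A → P' A = P (T ⁻¹' A) := fun A hA => by
    rw [hP', hP, withDensity_apply _ hA, withDensity_apply _ (hT hA), ← hQ,
      setLIntegral_map hA (by fun_prop) hT]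
  haveI : Nonempty {s : Set Ω // MeasurableSet s} := ⟨⟨∅, .empty⟩⟩
  haveI : Nonempty {s : Set ℝ // MeasurableSet s} := ⟨⟨∅, .empty⟩⟩
  unfold hsDiv
  apply le_antisymm
  · refine ciSup_le fun Γ => ?_
    have hA : MeasurableSet {x | Real.exp ε < g x} := measurableSet_lt measurable_const hg
    refine le_trans ?_ (le_ciSup hb' ⟨{x | Real.exp ε < g x}, hA⟩)
    simp only [hmapQ _ hA, hmapP _ hA]
    have hint : Integrable (fun x => g (T x)) Q := by
      refine ⟨(hg.comp hT).aestronglyMeasurable, ?_⟩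
      rw [hasFiniteIntegral_iff_ofReal (Filter.Eventually.of_forall fun x => hg0 _)]
      have : P Set.univ = 1 := measure_univ
      rw [hP, withDensity_apply _ .univ, setLIntegral_univ] at this
      rw [this]; exact ENNReal.one_lt_top
    have key : ∀ B, MeasurableSet B → (P B).toReal - Real.exp ε * (Q B).toReal
        = ∫ x, B.indicator (fun x => g (T x) - Real.exp ε) x ∂Q := by
      intro B hB
      rw [integral_indicator hB, integral_sub hint.integrableOn (integrable_const _)]
      congr 1
      · rw [hP, withDensity_apply _ hB, integral_eq_lintegral_of_nonneg_ae
          (Filter.Eventually.of_forall fun x => hg0 _) (hg.comp hT).aestronglyMeasurable]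
      · simp [measureReal_def, mul_comm]
    rw [key _ Γ.2, key _ (hT hA)]
    have hi : Integrable (fun x => g (T x) - Real.exp ε) Q := hint.sub (integrable_const _)
    refine integral_mono (hi.indicator Γ.2) (hi.indicator (hT hA)) fun x => ?_
    by_cases h1 : Real.exp ε < g (T x) <;> by_cases h2 : x ∈ Γ.1 <;>
      simp [Set.indicator, h1, h2] <;> linarith
  · refine ciSup_le fun Γ => ?_
    rw [hmapQ _ Γ.2, hmapP _ Γ.2]
    exact le_ciSup (hb P Q) ⟨T ⁻¹' Γ.1, hT Γ.2⟩

theorem stmt_4 (d : ℕ) (hd : 1 ≤ d) (μ₁ μ₂ : Fin d → ℝ) (σ : ℝ) (hσ : 0 < σ) (ε : ℝ) :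
    hsDiv ε (Measure.pi fun i : Fin d => gaussianReal (μ₁ i) (Real.toNNReal (σ ^ 2)))
        (Measure.pi fun i : Fin d => gaussianReal (μ₂ i) (Real.toNNReal (σ ^ 2)))
      = hsDiv ε (gaussianReal (Real.sqrt (∑ i, (μ₁ i - μ₂ i) ^ 2)) (Real.toNNReal (σ ^ 2)))
          (gaussianReal 0 (Real.toNNReal (σ ^ 2))) := by
  set r := Real.sqrt (∑ i, (μ₁ i - μ₂ i) ^ 2) with hr
  have hnn : 0 ≤ ∑ i, (μ₁ i - μ₂ i) ^ 2 := Finset.sum_nonneg fun i _ => sq_nonneg _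
  have hr2 : r ^ 2 = ∑ i, (μ₁ i - μ₂ i) ^ 2 := Real.sq_sqrt hnn
  obtain ⟨u, hu1, hu2⟩ : ∃ u : Fin d → ℝ, ∑ i, u i ^ 2 = 1 ∧ ∀ i, μ₁ i - μ₂ i = r * u i := by
    by_cases h : r = 0
    · refine ⟨Pi.single ⟨0, hd⟩ 1, ?_, fun i => ?_⟩
      · rw [Finset.sum_eq_single ⟨0, hd⟩] <;> simp +contextual [Pi.single_apply]
      · rw [h, zero_pow two_ne_zero, eq_comm,
          Finset.sum_eq_zero_iff_of_nonneg fun i _ => sq_nonneg _] at hr2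
        rw [h, zero_mul]
        exact pow_eq_zero_iff two_ne_zero |>.1 (hr2 i (Finset.mem_univ i))
    · refine ⟨fun i => (μ₁ i - μ₂ i) / r, ?_, fun i => by field_simp⟩
      simp_rw [div_pow]
      rw [← Finset.sum_div, ← hr2]
      field_simp
  refine aux_hs ε _ _ _ _ (fun x => ∑ i, u i * (x i - μ₂ i)) (by fun_prop)
    (fun y => Real.exp ((r * y - r ^ 2 / 2) / σ ^ 2)) (by fun_prop) (fun x => (Real.exp_pos _).le)
    (aux_map_s4 μ₂ u hu1 _) ?_ ?_
  · have hden := fun i => aux_gauss_density (μ₁ i) (μ₂ i) σ hσ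
    haveI : ∀ i, SigmaFinite ((gaussianReal (μ₂ i) (Real.toNNReal (σ ^ 2))).withDensity
      (fun x => ENNReal.ofReal (Real.exp
        (((μ₁ i - μ₂ i) * (x - μ₂ i) - (μ₁ i - μ₂ i) ^ 2 / 2) / σ ^ 2)))) := fun i => by
      rw [← hden i]; infer_instance
    simp_rw [hden]
    rw [aux_pi_withDensity _ _ (fun i => by fun_prop)]
    congr 1
    funext x
    rw [← ENNReal.ofReal_prod_of_nonneg fun i _ => (Real.exp_pos _).le, ← Real.exp_sum,
      ← Finset.sum_div, Finset.sum_sub_distrib, ← Finset.sum_div, ← hr2, Finset.mul_sum]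
    congr 4
    refine Finset.sum_congr rfl fun i _ => ?_
    rw [hu2 i]; ring
  · have := aux_gauss_density r 0 σ hσ
    simpa using this
end

section
/- (Composition of dominating pairs, non-adaptive product form.) Let P₁, Q₁, A₁, B₁ be probability measures on a standard Borel space Ω₁, and P₂, Q₂, A₂, B₂ probability measures on a standard Borel space Ω₂. If D_{e^ε}(P₁ ‖ Q₁) ≥ D_{e^ε}(A₁ ‖ B₁) for all ε ∈ ℝ and D_{e^ε}(P₂ ‖ Q₂) ≥ D_{e^ε}(A₂ ‖ B₂) for all ε ∈ ℝ, then D_{e^ε}(P₁ ⊗ P₂ ‖ Q₁ ⊗ Q₂) ≥ D_{e^ε}(A₁ ⊗ A₂ ‖ B₁ ⊗ B₂) for all ε ∈ ℝ. -/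
open MeasureTheory ProbabilityTheory

lemma hs_bdd {Ω : Type*} [MeasurableSpace Ω] (ε : ℝ) (P Q : Measure Ω)
    [IsProbabilityMeasure P] :
    BddAbove (Set.range fun Γ : {s : Set Ω // MeasurableSet s} =>
      ((P Γ.1).toReal - Real.exp ε * (Q Γ.1).toReal)) := by
  refine ⟨1, ?_⟩
  rintro _ ⟨Γ, rfl⟩
  have h1 : (P Γ.1).toReal ≤ 1 := measureReal_le_one
  have h2 : 0 ≤ Real.exp ε * (Q Γ.1).toReal := by positivity
  simp only
  linarith

lemma hs_opt {Ω : Type*} [MeasurableSpace Ω] (P Q μ : Measure Ω)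
    [IsProbabilityMeasure P] [IsProbabilityMeasure Q] [IsFiniteMeasure μ]
    (hP : P ≪ μ) (hQ : Q ≪ μ) (a b : ℝ) (T : Set Ω) (hT : MeasurableSet T) :
    a * (P T).toReal - b * (Q T).toReal ≤
    a * (P {x | 0 ≤ a * (P.rnDeriv μ x).toReal - b * (Q.rnDeriv μ x).toReal}).toReal
     - b * (Q {x | 0 ≤ a * (P.rnDeriv μ x).toReal - b * (Q.rnDeriv μ x).toReal}).toReal := by
  have key : ∀ S : Set Ω, MeasurableSet S → a * (P S).toReal - b * (Q S).toReal =
      ∫ x in S, (a * (P.rnDeriv μ x).toReal - b * (Q.rnDeriv μ x).toReal) ∂μ := by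
    intro S hS
    have i1 : Integrable (fun x => (P.rnDeriv μ x).toReal) μ := Measure.integrable_toReal_rnDeriv
    have i2 : Integrable (fun x => (Q.rnDeriv μ x).toReal) μ := Measure.integrable_toReal_rnDeriv
    rw [integral_sub (i1.integrableOn.const_mul a) (i2.integrableOn.const_mul b),
      integral_const_mul, integral_const_mul, Measure.setIntegral_toReal_rnDeriv hP,
      Measure.setIntegral_toReal_rnDeriv hQ]
    rfl
  have hm : Measurable (fun x => a * (P.rnDeriv μ x).toReal - b * (Q.rnDeriv μ x).toReal) := by
    fun_prop
  have hG : MeasurableSet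
      {x | 0 ≤ a * (P.rnDeriv μ x).toReal - b * (Q.rnDeriv μ x).toReal} :=
    measurableSet_le measurable_const hm
  rw [key T hT, key _ hG]
  refine setIntegral_le_nonneg hT hm.stronglyMeasurable ?_
  exact (Measure.integrable_toReal_rnDeriv.const_mul a).sub
    (Measure.integrable_toReal_rnDeriv.const_mul b)

lemma hs_pt {Ω : Type*} [MeasurableSpace Ω] (P Q A B μ : Measure Ω)
    [IsProbabilityMeasure P] [IsProbabilityMeasure Q] [IsFiniteMeasure μ]
    [IsProbabilityMeasure A] [IsProbabilityMeasure B]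
    (hP : P ≪ μ) (hQ : Q ≪ μ) (h : ∀ ε : ℝ, hsDiv ε A B ≤ hsDiv ε P Q)
    (a b : ℝ) (ha : 0 ≤ a) (hb : 0 ≤ b) (T : Set Ω) (hT : MeasurableSet T) :
    a * (A T).toReal - b * (B T).toReal ≤
    a * (P {x | 0 ≤ a * (P.rnDeriv μ x).toReal - b * (Q.rnDeriv μ x).toReal}).toReal
     - b * (Q {x | 0 ≤ a * (P.rnDeriv μ x).toReal - b * (Q.rnDeriv μ x).toReal}).toReal := by
  have opt := hs_opt P Q μ hP hQ a b
  have hBT : 0 ≤ b * (B T).toReal := by positivity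
  rcases ha.eq_or_lt with ha0 | ha0
  · have := opt ∅ .empty
    simp only [measure_empty, ENNReal.toReal_zero, mul_zero, sub_zero] at this
    have e : a * (A T).toReal = 0 := by rw [← ha0, zero_mul]
    linarith
  rcases hb.eq_or_lt with hb0 | hb0
  · have := opt Set.univ .univ
    have h1 : (A T).toReal ≤ 1 := measureReal_le_one
    have h2 : a * (A T).toReal ≤ a * 1 := by gcongr
    have e : b * (Q Set.univ).toReal = 0 := by rw [← hb0, zero_mul]
    simp only [measure_univ, ENNReal.toReal_one] at this e
    linarith
  have he : Real.exp (Real.log (b / a)) = b / a := Real.exp_log (by positivity)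
  have s1 : (A T).toReal - Real.exp (Real.log (b / a)) * (B T).toReal
      ≤ hsDiv (Real.log (b / a)) A B := le_ciSup (hs_bdd _ A B) ⟨T, hT⟩
  have hne : Nonempty {s : Set Ω // MeasurableSet s} := ⟨⟨∅, .empty⟩⟩
  have s2 : hsDiv (Real.log (b / a)) P Q ≤
    (a * (P {x | 0 ≤ a * (P.rnDeriv μ x).toReal - b * (Q.rnDeriv μ x).toReal}).toReal
     - b * (Q {x | 0 ≤ a * (P.rnDeriv μ x).toReal - b * (Q.rnDeriv μ x).toReal}).toReal) / a := by
    refine ciSup_le fun Γ => ?_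
    rw [le_div_iff₀ ha0, he]
    refine le_trans (le_of_eq ?_) (opt Γ.1 Γ.2)
    field_simp
  have s3 := (s1.trans (h _)).trans s2
  rw [le_div_iff₀ ha0, he] at s3
  refine le_trans (le_of_eq ?_) s3
  field_simp

lemma hs_meas {Ω Ψ : Type*} [MeasurableSpace Ω] [MeasurableSpace Ψ]
    (A : Measure Ω) [IsProbabilityMeasure A] (Γ : Set (Ω × Ψ)) (hΓ : MeasurableSet Γ) :
    Measurable fun y => (A ((fun x => (x, y)) ⁻¹' Γ)).toReal :=
  (measurable_measure_prodMk_right hΓ).ennreal_toReal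

lemma hs_int {Ω Ψ : Type*} [MeasurableSpace Ω] [MeasurableSpace Ψ]
    (A : Measure Ω) (R ν : Measure Ψ) [IsProbabilityMeasure A] [IsProbabilityMeasure R]
    [IsFiniteMeasure ν] (Γ : Set (Ω × Ψ)) (hΓ : MeasurableSet Γ) :
    Integrable (fun y => (R.rnDeriv ν y).toReal * (A ((fun x => (x, y)) ⁻¹' Γ)).toReal) ν := by
  refine Measure.integrable_toReal_rnDeriv.mul_bdd (c := 1)
    (hs_meas A Γ hΓ).aestronglyMeasurable ?_
  refine .of_forall fun y => ?_
  rw [Real.norm_of_nonneg ENNReal.toReal_nonneg]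
  exact measureReal_le_one

lemma hs_prod {Ω Ψ : Type*} [MeasurableSpace Ω] [MeasurableSpace Ψ]
    (A : Measure Ω) (R ν : Measure Ψ) [IsProbabilityMeasure A] [IsProbabilityMeasure R]
    [IsFiniteMeasure ν] (hR : R ≪ ν) (Γ : Set (Ω × Ψ)) (hΓ : MeasurableSet Γ) :
    ((A.prod R) Γ).toReal =
      ∫ y, (R.rnDeriv ν y).toReal * (A ((fun x => (x, y)) ⁻¹' Γ)).toReal ∂ν := by
  have := integral_rnDeriv_smul hR (f := fun y => (A ((fun x => (x, y)) ⁻¹' Γ)).toReal)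
  simp only [smul_eq_mul] at this
  rw [this, Measure.prod_apply_symm hΓ, integral_toReal]
  · exact (measurable_measure_prodMk_right hΓ).aemeasurable
  · exact .of_forall fun y => measure_lt_top _ _

lemma hs_left {Ω Ψ : Type*} [MeasurableSpace Ω] [MeasurableSpace Ψ]
    (P Q A B : Measure Ω) (R S : Measure Ψ)
    [IsProbabilityMeasure P] [IsProbabilityMeasure Q]
    [IsProbabilityMeasure A] [IsProbabilityMeasure B]
    [IsProbabilityMeasure R] [IsProbabilityMeasure S]
    (h : ∀ ε : ℝ, hsDiv ε A B ≤ hsDiv ε P Q) (ε : ℝ) :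
    hsDiv ε (A.prod R) (B.prod S) ≤ hsDiv ε (P.prod R) (Q.prod S) := by
  have hne : Nonempty {s : Set (Ω × Ψ) // MeasurableSet s} := ⟨⟨∅, .empty⟩⟩
  refine ciSup_le fun ⟨Γ, hΓ⟩ => ?_
  have hP : P ≪ P + Q := Measure.AbsolutelyContinuous.rfl.add_right Q
  have hQ : Q ≪ P + Q := by
    rw [add_comm]; exact Measure.AbsolutelyContinuous.rfl.add_right P
  have hR : R ≪ R + S := Measure.AbsolutelyContinuous.rfl.add_right S
  have hS : S ≪ R + S := by
    rw [add_comm]; exact Measure.AbsolutelyContinuous.rfl.add_right R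
  let G : Set (Ω × Ψ) := {z | 0 ≤ (R.rnDeriv (R + S) z.2).toReal * (P.rnDeriv (P + Q) z.1).toReal
    - (Real.exp ε * (S.rnDeriv (R + S) z.2).toReal) * (Q.rnDeriv (P + Q) z.1).toReal}
  have hG : MeasurableSet G := measurableSet_le measurable_const (by fun_prop)
  refine le_trans ?_ (le_ciSup (hs_bdd ε (P.prod R) (Q.prod S)) ⟨G, hG⟩)
  simp only
  rw [hs_prod A R (R + S) hR Γ hΓ, hs_prod B S (R + S) hS Γ hΓ,
    hs_prod P R (R + S) hR G hG, hs_prod Q S (R + S) hS G hG,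
    ← integral_const_mul, ← integral_const_mul,
    ← integral_sub (hs_int A R _ Γ hΓ) ((hs_int B S _ Γ hΓ).const_mul _),
    ← integral_sub (hs_int P R _ G hG) ((hs_int Q S _ G hG).const_mul _)]
  refine integral_mono ((hs_int A R _ Γ hΓ).sub ((hs_int B S _ Γ hΓ).const_mul _))
    ((hs_int P R _ G hG).sub ((hs_int Q S _ G hG).const_mul _)) fun y => ?_
  have := hs_pt P Q A B (P + Q) hP hQ h (R.rnDeriv (R + S) y).toReal
    (Real.exp ε * (S.rnDeriv (R + S) y).toReal) ENNReal.toReal_nonneg (by positivity)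
    ((fun x => (x, y)) ⁻¹' Γ) (measurable_prodMk_right hΓ)
  simp only [← mul_assoc]
  exact this

lemma hs_swap {Ω Ψ : Type*} [MeasurableSpace Ω] [MeasurableSpace Ψ]
    (P Q : Measure Ω) (R S : Measure Ψ)
    [IsProbabilityMeasure P] [IsProbabilityMeasure Q]
    [IsProbabilityMeasure R] [IsProbabilityMeasure S] (ε : ℝ) :
    hsDiv ε (P.prod R) (Q.prod S) ≤ hsDiv ε (R.prod P) (S.prod Q) := by
  have hne : Nonempty {s : Set (Ω × Ψ) // MeasurableSet s} := ⟨⟨∅, .empty⟩⟩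
  refine ciSup_le fun ⟨Γ, hΓ⟩ => ?_
  refine le_trans (le_of_eq ?_)
    (le_ciSup (hs_bdd ε (R.prod P) (S.prod Q)) ⟨Prod.swap ⁻¹' Γ, measurable_swap hΓ⟩)
  simp only
  rw [← Measure.map_apply measurable_swap hΓ, ← Measure.map_apply measurable_swap hΓ,
    Measure.prod_swap, Measure.prod_swap]

/-- Composition of dominating pairs (non-adaptive product form). -/
theorem stmt_7 {Ω₁ Ω₂ : Type*} [MeasurableSpace Ω₁] [StandardBorelSpace Ω₁]
    [MeasurableSpace Ω₂] [StandardBorelSpace Ω₂]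
    (P₁ Q₁ A₁ B₁ : Measure Ω₁) (P₂ Q₂ A₂ B₂ : Measure Ω₂)
    [IsProbabilityMeasure P₁] [IsProbabilityMeasure Q₁]
    [IsProbabilityMeasure A₁] [IsProbabilityMeasure B₁]
    [IsProbabilityMeasure P₂] [IsProbabilityMeasure Q₂]
    [IsProbabilityMeasure A₂] [IsProbabilityMeasure B₂]
    (h₁ : ∀ ε : ℝ, hsDiv ε A₁ B₁ ≤ hsDiv ε P₁ Q₁)
    (h₂ : ∀ ε : ℝ, hsDiv ε A₂ B₂ ≤ hsDiv ε P₂ Q₂) :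
    ∀ ε : ℝ, hsDiv ε (A₁.prod A₂) (B₁.prod B₂) ≤ hsDiv ε (P₁.prod P₂) (Q₁.prod Q₂) := by
  intro ε
  refine (hs_left P₁ Q₁ A₁ B₁ A₂ B₂ h₁ ε).trans ?_
  refine (hs_swap _ _ _ _ ε).trans ?_
  exact (hs_left P₂ Q₂ A₂ B₂ P₁ Q₁ h₂ ε).trans (hs_swap _ _ _ _ ε)
end

section
/- Let n, b, T be positive integers such that E := bT/n and S := n/b are integers, and let σ > 0. For s ∈ {1, …, S} define f_s := ∑_{ℓ=0}^{E−1} e_{ℓ·S+s} ∈ ℝ^T and let 𝟏 ∈ ℝ^T be the all-ones vector. Define on ℝ^T the mixtures U := (1/S)·∑_{s=1}^S N(−b·𝟏 + 2f_s, σ²I_T) and V := (1/S)·∑_{s=1}^S N(−b·𝟏 + f_s, σ²I_T), and on ℝ^S the mixtures P_SP := (1/S)·∑_{s=1}^S N(2e_s, (σ²/E)·I_S) and Q_SP := (1/S)·∑_{s=1}^S N(e_s, (σ²/E)·I_S). Then for every ε ∈ ℝ, D_{e^ε}(U ‖ V) = D_{e^ε}(P_SP ‖ Q_SP). -/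
open MeasureTheory ProbabilityTheory
open scoped ENNReal NNReal

/-- The indicator `f_s = ∑_{ℓ=0}^{E−1} e_{ℓ·S+s}` (0-indexed): its `t`-th coordinate is `1`
iff `t ≡ s (mod S)`. -/
noncomputable def fvec (S : ℕ) (s : ℕ) (t : ℕ) : ℝ := if t % S = s % S then 1 else 0

lemma gauss_shift (m a : ℝ) (v : ℝ≥0) (hv : v ≠ 0) :
    gaussianReal (m + a) v = (gaussianReal m v).withDensity
      (fun x => ENNReal.ofReal (Real.exp (a * (x - m) / v - a ^ 2 / (2 * v)))) := by
  rw [gaussianReal_of_var_ne_zero _ hv, gaussianReal_of_var_ne_zero _ hv,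
    ← withDensity_mul _ (by fun_prop) (by fun_prop)]
  congr 1
  ext x
  have hv' : (v : ℝ) ≠ 0 := by exact_mod_cast hv
  simp only [Pi.mul_apply, gaussianPDF]
  rw [← ENNReal.ofReal_mul (gaussianPDFReal_nonneg _ _ _)]
  congr 1
  simp only [gaussianPDFReal]
  rw [mul_assoc _ (Real.exp _) (Real.exp _), ← Real.exp_add]
  congr 2
  field_simp
  ring

lemma pi_withDens {ι : Type*} [Fintype ι] (μ : ι → Measure ℝ) [∀ i, IsProbabilityMeasure (μ i)]
    (f : ι → ℝ → ℝ≥0∞) (hf : ∀ i, Measurable (f i))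
    [∀ i, SigmaFinite ((μ i).withDensity (f i))] :
    Measure.pi (fun i => (μ i).withDensity (f i))
      = (Measure.pi μ).withDensity (fun x => ∏ i, f i (x i)) := by
  refine Measure.pi_eq fun s hs => ?_
  rw [withDensity_apply _ (MeasurableSet.univ_pi hs), ← lintegral_indicator (MeasurableSet.univ_pi hs)]
  have key : ∀ x : ι → ℝ, (Set.univ.pi s).indicator (fun x => ∏ i, f i (x i)) x
      = ∏ i, (s i).indicator (f i) (x i) := by
    intro x
    by_cases hx : x ∈ Set.univ.pi s
    · rw [Set.indicator_of_mem hx]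
      refine Finset.prod_congr rfl fun i _ => ?_
      rw [Set.indicator_of_mem (hx i (Set.mem_univ i))]
    · rw [Set.indicator_of_notMem hx]
      simp only [Set.mem_pi, Set.mem_univ, true_imp_iff, not_forall] at hx
      obtain ⟨i, hi⟩ := hx
      symm
      exact Finset.prod_eq_zero (Finset.mem_univ i) (Set.indicator_of_notMem hi _)
  simp_rw [key]
  have hm : ∀ i, Measurable ((s i).indicator (f i)) := fun i => (hf i).indicator (hs i)
  rw [lintegral_prod_eq_prod_lintegral_of_indepFun Finset.univ
    (fun i (x : ι → ℝ) => (s i).indicator (f i) (x i))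
    (iIndepFun_pi (fun i => (hm i).aemeasurable))
    (fun i => (hm i).comp (measurable_pi_apply i))]
  refine Finset.prod_congr rfl fun i _ => ?_
  rw [withDensity_apply _ (hs i), ← lintegral_indicator (hs i),
    ← lintegral_map (hm i) (measurable_pi_apply i)]
  rw [(measurePreserving_eval μ i).map_eq]

lemma pi_shift {ι : Type*} [Fintype ι] (m a : ι → ℝ) (v : ℝ≥0) (hv : v ≠ 0) :
    Measure.pi (fun i => gaussianReal (m i + a i) v)
      = (Measure.pi fun i => gaussianReal (m i) v).withDensity
        (fun x => ENNReal.ofReal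
          (Real.exp (∑ i, (a i * (x i - m i) / v - a i ^ 2 / (2 * v))))) := by
  have h : ∀ i, gaussianReal (m i + a i) v = (gaussianReal (m i) v).withDensity
      (fun x => ENNReal.ofReal (Real.exp (a i * (x - m i) / v - a i ^ 2 / (2 * v)))) :=
    fun i => gauss_shift _ _ v hv
  have : ∀ i, SigmaFinite ((gaussianReal (m i) v).withDensity
      (fun x => ENNReal.ofReal (Real.exp (a i * (x - m i) / v - a i ^ 2 / (2 * v))))) := by
    intro i
    rw [← h i]
    infer_instance
  simp_rw [h]
  rw [pi_withDens _ _ (fun i => by fun_prop)]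
  congr 1
  ext x
  rw [Real.exp_sum, ENNReal.ofReal_prod_of_nonneg (fun i _ => (Real.exp_pos _).le)]

lemma map_avg {ι κ : Type*} [Fintype ι] [Fintype κ] [DecidableEq κ] (c : ι → κ) (E : ℕ)
    (hE : 0 < E) (hc : ∀ g : κ → ℝ, ∑ t, g (c t) = E * ∑ k, g k) (b σ : ℝ) :
    (Measure.pi fun _ : ι => gaussianReal (-b) (Real.toNNReal (σ ^ 2))).map
      (fun x k => (∑ t, if c t = k then x t + b else 0) / E)
    = Measure.pi fun _ : κ => gaussianReal 0 (Real.toNNReal (σ ^ 2 / E)) := by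
  have hE' : (E : ℝ) ≠ 0 := by positivity
  have hA : Measurable (fun (x : ι → ℝ) (k : κ) => (∑ t, if c t = k then x t + b else 0) / (E : ℝ)) := by
    refine measurable_pi_lambda _ fun k => ?_
    refine Measurable.div_const (Finset.measurable_sum _ fun t _ => ?_) _
    split_ifs <;> fun_prop
  apply (MeasurableEquiv.toLp 2 (κ → ℝ)).map_measurableEquiv_injective
  have : IsProbabilityMeasure ((Measure.pi fun _ : ι => gaussianReal (-b) (Real.toNNReal (σ ^ 2))).map
      (fun x k => (∑ t, if c t = k then x t + b else 0) / (E : ℝ))) :=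
    Measure.isProbabilityMeasure_map hA.aemeasurable
  apply Measure.ext_of_charFun (E := EuclideanSpace ℝ κ)
  ext u
  rw [MeasurableEquiv.coe_toLp, charFun_pi, charFun_apply, integral_map (by fun_prop) (by fun_prop),
    integral_map hA.aemeasurable (by fun_prop)]
  have e1 : ∀ x : ι → ℝ, Complex.exp ((inner ℝ ((WithLp.toLp 2
      (fun k => (∑ t, if c t = k then x t + b else 0) / (E : ℝ))) : EuclideanSpace ℝ κ) u : ℝ) * Complex.I)
      = ∏ t, Complex.exp ((u (c t) / E : ℝ) * (x t + b) * Complex.I) := by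
    intro x
    rw [← Complex.exp_sum, ← Finset.sum_mul]
    congr 2
    rw [PiLp.inner_apply]
    simp only [RCLike.inner_apply, conj_trivial]
    have : ∑ k, u k * ((∑ t, if c t = k then x t + b else 0) / (E : ℝ))
        = ∑ t, u (c t) / E * (x t + b) := by
      simp_rw [Finset.sum_div, Finset.mul_sum]
      rw [Finset.sum_comm]
      refine Finset.sum_congr rfl fun t _ => ?_
      rw [Finset.sum_eq_single (c t)]
      · simp; ring
      · intro k _ hk; simp [hk.symm]
      · simp
    rw [this]
    push_cast
    rfl
  simp_rw [e1]
  rw [integral_fintype_prod_eq_prod (𝕜 := ℂ) (fun (t : ι) (x : ℝ) => Complex.exp ((u (c t) / E : ℝ) * (x + b) * Complex.I))]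
  have e2 : ∀ w : ℝ, ∫ x, Complex.exp ((w : ℂ) * (x + b) * Complex.I) ∂gaussianReal (-b) (Real.toNNReal (σ ^ 2))
      = Complex.exp ((-(σ ^ 2 * w ^ 2 / 2) : ℝ)) := by
    intro w
    have h1 := charFun_apply_real (μ := gaussianReal 0 (Real.toNNReal (σ ^ 2))) w
    rw [charFun_gaussianReal] at h1
    have h2 := gaussianReal_map_add_const (μ := -b) (v := Real.toNNReal (σ ^ 2)) b
    rw [neg_add_cancel] at h2
    rw [← h2, integral_map (by fun_prop) (by fun_prop)] at h1
    push_cast at h1 ⊢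
    rw [← h1]
    congr 1
    have : ((Real.toNNReal (σ ^ 2) : ℝ) : ℂ) = (σ : ℂ) ^ 2 := by
      rw [Real.coe_toNNReal _ (by positivity)]; push_cast; rfl
    rw [this]; ring
  simp_rw [e2, charFun_gaussianReal]
  rw [← Complex.exp_sum, ← Complex.exp_sum]
  congr 1
  have h3 : ((Real.toNNReal (σ ^ 2 / E) : ℝ) : ℂ) = ((σ ^ 2 / E : ℝ) : ℂ) := by
    rw [Real.coe_toNNReal _ (by positivity)]
  simp only [h3]
  rw [← Complex.ofReal_sum, hc (fun k => -(σ ^ 2 * (u k / E) ^ 2 / 2)), Finset.mul_sum]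
  push_cast
  refine Finset.sum_congr rfl fun k _ => ?_
  have hE'' : (E : ℂ) ≠ 0 := by exact_mod_cast hE'
  field_simp
  ring

lemma hsDiv_map {X Y : Type*} [MeasurableSpace X] [MeasurableSpace Y] (μ : Measure X) (A : X → Y)
    (hA : Measurable A) (p q : Y → ℝ≥0∞) (hp : Measurable p) (hq : Measurable q) (ε : ℝ)
    [IsFiniteMeasure (μ.withDensity (fun x => p (A x)))]
    [IsFiniteMeasure (μ.withDensity (fun x => q (A x)))] :
    hsDiv ε (μ.withDensity (fun x => p (A x))) (μ.withDensity (fun x => q (A x)))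
      = hsDiv ε ((μ.map A).withDensity p) ((μ.map A).withDensity q) := by
  have hm : ∀ r : Y → ℝ≥0∞, Measurable r → ∀ s, MeasurableSet s →
      (μ.map A).withDensity r s = μ.withDensity (fun x => r (A x)) (A ⁻¹' s) := by
    intro r hr s hs
    rw [withDensity_apply _ hs, withDensity_apply _ (hA hs), setLIntegral_map hs hr hA]
  set U := μ.withDensity (fun x => p (A x)) with hU
  set V := μ.withDensity (fun x => q (A x)) with hV
  have bdd : ∀ (Γ : Set X), (U Γ).toReal - Real.exp ε * (V Γ).toReal ≤ (U Set.univ).toReal := by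
    intro Γ
    have h1 : (U Γ).toReal ≤ (U Set.univ).toReal :=
      ENNReal.toReal_mono (measure_ne_top _ _) (measure_mono (Set.subset_univ _))
    have h2 : 0 ≤ Real.exp ε * (V Γ).toReal := by positivity
    linarith
  unfold hsDiv
  have : Nonempty {s : Set X // MeasurableSet s} := ⟨⟨∅, MeasurableSet.empty⟩⟩
  have : Nonempty {s : Set Y // MeasurableSet s} := ⟨⟨∅, MeasurableSet.empty⟩⟩
  apply le_antisymm
  · refine ciSup_le fun ⟨Γ, hΓ⟩ => ?_
    have hG : MeasurableSet {y | ENNReal.ofReal (Real.exp ε) * q y ≤ p y} :=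
      measurableSet_le (hq.const_mul _) hp
    refine le_trans ?_ (le_ciSup (f := fun Γ : {s : Set Y // MeasurableSet s} =>
      ((((μ.map A).withDensity p) Γ.1).toReal
        - Real.exp ε * (((μ.map A).withDensity q) Γ.1).toReal)) ?_ ⟨_, hG⟩)
    · simp only
      rw [hm p hp _ hG, hm q hq _ hG, ← hU, ← hV]
      set B := A ⁻¹' {y | ENNReal.ofReal (Real.exp ε) * q y ≤ p y} with hBdef
      have hB : MeasurableSet B := hA hG
      have s1 : (U (Γ \ B)).toReal ≤ Real.exp ε * (V (Γ \ B)).toReal := by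
        rw [← ENNReal.toReal_ofReal (Real.exp_pos ε).le, ← ENNReal.toReal_mul]
        refine ENNReal.toReal_mono (ENNReal.mul_ne_top ENNReal.ofReal_ne_top (measure_ne_top _ _)) ?_
        rw [hU, hV, withDensity_apply _ (hΓ.diff hB), withDensity_apply _ (hΓ.diff hB),
          ← lintegral_const_mul _ (show Measurable fun x => q (A x) from hq.comp hA)]
        refine setLIntegral_mono ((hq.comp hA).const_mul _) fun x hx => ?_
        exact (not_le.mp hx.2).le
      have s2 : Real.exp ε * (V (B \ Γ)).toReal ≤ (U (B \ Γ)).toReal := by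
        rw [← ENNReal.toReal_ofReal (Real.exp_pos ε).le, ← ENNReal.toReal_mul]
        refine ENNReal.toReal_mono (measure_ne_top _ _) ?_
        rw [hU, hV, withDensity_apply _ (hB.diff hΓ), withDensity_apply _ (hB.diff hΓ),
          ← lintegral_const_mul _ (show Measurable fun x => q (A x) from hq.comp hA)]
        exact setLIntegral_mono (hp.comp hA) fun x hx => hx.1
      have d : ∀ (W : Measure X) [IsFiniteMeasure W] (s t : Set X), MeasurableSet t →
          (W s).toReal = (W (s ∩ t)).toReal + (W (s \ t)).toReal := by
        intro W _ s t ht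
        rw [← ENNReal.toReal_add (measure_ne_top _ _) (measure_ne_top _ _),
          measure_inter_add_sdiff _ ht]
      rw [d U Γ B hB, d V Γ B hB, d U B Γ hΓ, d V B Γ hΓ, Set.inter_comm B Γ]
      linarith
    · refine ⟨(U Set.univ).toReal, ?_⟩
      rintro _ ⟨⟨s, hs⟩, rfl⟩
      simp only
      rw [hm p hp _ hs, hm q hq _ hs]
      exact bdd _
  · refine ciSup_le fun ⟨s, hs⟩ => ?_
    simp only
    rw [hm p hp _ hs, hm q hq _ hs]
    refine le_ciSup (f := fun Γ : {s : Set X // MeasurableSet s} =>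
      ((U Γ.1).toReal - Real.exp ε * (V Γ.1).toReal)) ?_ ⟨A ⁻¹' s, hA hs⟩
    refine ⟨(U Set.univ).toReal, ?_⟩
    rintro _ ⟨⟨s, hs⟩, rfl⟩
    exact bdd _

lemma mix_withDensity {X κ : Type*} [MeasurableSpace X] [Fintype κ] (μ : Measure X) (r : ℝ≥0∞)
    (h : κ → X → ℝ≥0∞) (hh : ∀ s, Measurable (h s)) :
    r • ∑ s, μ.withDensity (h s) = μ.withDensity (fun x => r * ∑ s, h s x) := by
  ext t ht
  rw [withDensity_apply _ ht, lintegral_const_mul _ (Finset.measurable_sum _ fun s _ => hh s),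
    lintegral_finsetSum _ (fun s _ => hh s)]
  simp [withDensity_apply _ ht]

lemma sum_mod (E S : ℕ) (hS : 0 < S) (g : Fin S → ℝ) :
    ∑ t : Fin (E * S), g ⟨(t : ℕ) % S, Nat.mod_lt _ hS⟩ = E * ∑ k, g k := by
  rw [← finProdFinEquiv.sum_comp, Fintype.sum_prod_type]
  have : ∀ (x : Fin E) (y : Fin S),
      (⟨((finProdFinEquiv (x, y) : Fin (E * S)) : ℕ) % S, Nat.mod_lt _ hS⟩ : Fin S) = y := by
    intro x y
    ext
    simp [finProdFinEquiv, Nat.add_mul_mod_self_left, Nat.mod_eq_of_lt y.2]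
  simp only [this]
  simp

lemma dens_eq (E S : ℕ) (hE : 0 < E) (hS : 0 < S) (σ b k : ℝ) (hσ : 0 < σ) (s : Fin S)
    (x : Fin (E * S) → ℝ) :
    ∑ t : Fin (E * S), (k * fvec S (s : ℕ) (t : ℕ) * (x t - -b) / (Real.toNNReal (σ ^ 2) : ℝ)
        - (k * fvec S (s : ℕ) (t : ℕ)) ^ 2 / (2 * (Real.toNNReal (σ ^ 2) : ℝ)))
    = ∑ i : Fin S, ((if i = s then k else 0) *
        ((∑ t : Fin (E * S), if (⟨(t : ℕ) % S, Nat.mod_lt _ hS⟩ : Fin S) = i then x t + b else 0) / (E : ℝ) - 0)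
          / (Real.toNNReal (σ ^ 2 / E) : ℝ)
        - (if i = s then k else 0) ^ 2 / (2 * (Real.toNNReal (σ ^ 2 / E) : ℝ))) := by
  rw [Real.coe_toNNReal _ (by positivity), Real.coe_toNNReal _ (by positivity)]
  have hE' : (E : ℝ) ≠ 0 := by positivity
  rw [Finset.sum_eq_single s (by intro i _ hi; simp [hi]) (by simp), Finset.sum_sub_distrib]
  have hf : ∀ t : Fin (E * S), fvec S (s : ℕ) (t : ℕ)
      = if (⟨(t : ℕ) % S, Nat.mod_lt _ hS⟩ : Fin S) = s then 1 else 0 := by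
    intro t
    simp [fvec, Fin.ext_iff, Nat.mod_eq_of_lt s.2]
  have h2 := sum_mod E S hS (fun i => (k * (if i = s then 1 else 0)) ^ 2 / (2 * σ ^ 2))
  simp only [hf]
  rw [h2, Finset.sum_eq_single s (by intro i _ hi; simp [hi]) (by simp)]
  simp only [if_true, sub_zero, Finset.sum_div, Finset.mul_sum]
  congr 1
  · refine Finset.sum_congr rfl fun t _ => ?_
    split_ifs
    · field_simp; ring
    · simp
  · field_simp

lemma main_aux (E S : ℕ) (hE : 0 < E) (hS : 0 < S) (σ b k l : ℝ) (hσ : 0 < σ) (ε : ℝ) :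
    hsDiv ε
        (((S : ℝ≥0∞))⁻¹ •
          ∑ s : Fin S, Measure.pi fun t : Fin (E * S) =>
            gaussianReal (-b + k * fvec S (s : ℕ) (t : ℕ)) (Real.toNNReal (σ ^ 2)))
        (((S : ℝ≥0∞))⁻¹ •
          ∑ s : Fin S, Measure.pi fun t : Fin (E * S) =>
            gaussianReal (-b + l * fvec S (s : ℕ) (t : ℕ)) (Real.toNNReal (σ ^ 2)))
      = hsDiv ε
          (((S : ℝ≥0∞))⁻¹ •
            ∑ s : Fin S, Measure.pi fun i : Fin S =>
              gaussianReal (if i = s then k else 0) (Real.toNNReal (σ ^ 2 / E)))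
          (((S : ℝ≥0∞))⁻¹ •
            ∑ s : Fin S, Measure.pi fun i : Fin S =>
              gaussianReal (if i = s then l else 0) (Real.toNNReal (σ ^ 2 / E))) := by
  have hE' : (0 : ℝ) < E := by positivity
  have hv : Real.toNNReal (σ ^ 2) ≠ 0 := (Real.toNNReal_pos.mpr (by positivity)).ne'
  have hv' : Real.toNNReal (σ ^ 2 / E) ≠ 0 := (Real.toNNReal_pos.mpr (by positivity)).ne'
  let c : Fin (E * S) → Fin S := fun t => ⟨(t : ℕ) % S, Nat.mod_lt _ hS⟩
  let A : (Fin (E * S) → ℝ) → (Fin S → ℝ) :=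
    fun x k => (∑ t, if c t = k then x t + b else 0) / E
  have hA : Measurable A := by
    refine measurable_pi_lambda _ fun k => ?_
    refine Measurable.div_const (Finset.measurable_sum _ fun t _ => ?_) _
    split_ifs <;> fun_prop
  let h : ℝ → Fin S → (Fin S → ℝ) → ℝ≥0∞ := fun k s y => ENNReal.ofReal (Real.exp
    (∑ i : Fin S, ((if i = s then k else 0) * (y i - 0) / (Real.toNNReal (σ ^ 2 / E) : ℝ)
        - (if i = s then k else 0) ^ 2 / (2 * (Real.toNNReal (σ ^ 2 / E) : ℝ)))))
  have hh : ∀ k s, Measurable (h k s) := by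
    intro k s
    simp only [h]
    fun_prop
  let r : ℝ → (Fin S → ℝ) → ℝ≥0∞ := fun k y => (S : ℝ≥0∞)⁻¹ * ∑ s, h k s y
  have hr : ∀ k, Measurable (r k) := fun k =>
    (Finset.measurable_sum _ fun s _ => hh k s).const_mul _
  set μ : Measure (Fin (E * S) → ℝ) :=
    Measure.pi fun _ => gaussianReal (-b) (Real.toNNReal (σ ^ 2)) with hμ
  have hmap : μ.map A = Measure.pi fun _ : Fin S => gaussianReal 0 (Real.toNNReal (σ ^ 2 / E)) :=
    map_avg c E hE (sum_mod E S hS) b σ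
  have hUk : ∀ k : ℝ, (((S : ℝ≥0∞))⁻¹ •
          ∑ s : Fin S, Measure.pi fun t : Fin (E * S) =>
            gaussianReal (-b + k * fvec S (s : ℕ) (t : ℕ)) (Real.toNNReal (σ ^ 2)))
      = μ.withDensity (fun x => r k (A x)) := by
    intro k
    have := mix_withDensity μ ((S : ℝ≥0∞)⁻¹) (fun s x => h k s (A x)) (fun s => (hh k s).comp hA)
    refine Eq.trans ?_ this
    congr 1
    refine Finset.sum_congr rfl fun s _ => ?_
    rw [pi_shift (fun _ => -b) (fun t : Fin (E * S) => k * fvec S (s : ℕ) (t : ℕ)) _ hv, hμ]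
    congr 1
    ext x
    rw [dens_eq E S hE hS σ b k hσ s x]
  have hPk : ∀ k : ℝ, (((S : ℝ≥0∞))⁻¹ •
            ∑ s : Fin S, Measure.pi fun i : Fin S =>
              gaussianReal (if i = s then k else 0) (Real.toNNReal (σ ^ 2 / E)))
      = (μ.map A).withDensity (r k) := by
    intro k
    rw [hmap]
    refine Eq.trans ?_ (mix_withDensity _ ((S : ℝ≥0∞)⁻¹) (h k) (hh k))
    congr 1
    refine Finset.sum_congr rfl fun s _ => ?_
    rw [← pi_shift (fun _ => 0) (fun i => if i = s then k else 0) _ hv']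
    simp
  have hfin : ∀ k, IsFiniteMeasure (μ.withDensity (fun x => r k (A x))) := by
    intro k
    rw [← hUk k]
    refine ⟨?_⟩
    have : (S : ℝ≥0∞) ≠ 0 := by exact_mod_cast hS.ne'
    simp [ENNReal.mul_lt_top_iff, ENNReal.inv_lt_top, pos_iff_ne_zero, hS.ne']
  have := hfin k
  have := hfin l
  rw [hUk, hUk, hPk, hPk]
  exact hsDiv_map μ A hA (r k) (r l) (hr k) (hr l) ε

theorem stmt_12 (n b T E S : ℕ) (hn : 0 < n) (hb : 0 < b) (hT : 0 < T)
    (hE : b * T = E * n) (hS : n = b * S) (σ : ℝ) (hσ : 0 < σ) (ε : ℝ) :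
    hsDiv ε
        -- `U = (1/S)·∑_s N(−b·𝟏 + 2·f_s, σ²·I_T)` on `ℝ^T`
        (((S : ℝ≥0∞))⁻¹ •
          ∑ s : Fin S, Measure.pi fun t : Fin T =>
            gaussianReal (-(b : ℝ) + 2 * fvec S (s : ℕ) (t : ℕ)) (Real.toNNReal (σ ^ 2)))
        -- `V = (1/S)·∑_s N(−b·𝟏 + f_s, σ²·I_T)` on `ℝ^T`
        (((S : ℝ≥0∞))⁻¹ •
          ∑ s : Fin S, Measure.pi fun t : Fin T =>
            gaussianReal (-(b : ℝ) + fvec S (s : ℕ) (t : ℕ)) (Real.toNNReal (σ ^ 2)))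
      = hsDiv ε
          -- `P_SP = (1/S)·∑_s N(2e_s, (σ²/E)·I_S)` on `ℝ^S`
          (((S : ℝ≥0∞))⁻¹ •
            ∑ s : Fin S, Measure.pi fun i : Fin S =>
              gaussianReal (if i = s then 2 else 0) (Real.toNNReal (σ ^ 2 / E)))
          -- `Q_SP = (1/S)·∑_s N(e_s, (σ²/E)·I_S)` on `ℝ^S`
          (((S : ℝ≥0∞))⁻¹ •
            ∑ s : Fin S, Measure.pi fun i : Fin S =>
              gaussianReal (if i = s then 1 else 0) (Real.toNNReal (σ ^ 2 / E))) := by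
  have hS0 : 0 < S := by
    rcases Nat.eq_zero_or_pos S with h | h
    · subst h; simp at hS; omega
    · exact h
  have hTE : T = E * S := by
    subst hS
    apply Nat.eq_of_mul_eq_mul_left hb
    rw [hE]; ring
  have hE0 : 0 < E := by
    rcases Nat.eq_zero_or_pos E with h | h
    · subst h; simp at hTE; omega
    · exact h
  subst hTE
  have := main_aux E S hE0 hS0 σ b 2 1 hσ ε
  simpa only [one_mul] using this
end
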